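/- arXiv:1306.2020 — 4 statements merged into one kernel-verified Lean document; each statement's English description precedes it below -/
import Mathlib

section
/- There exist a real number ρ (namely ρ = 6θ²(1−2θ) = 0.159181..., where θ = 0.427373... is the largest real root of x³ + x² − x + 1/6 = 0) with the following property: for every ε > 0 there exist δ > 0 and N ∈ ℕ such that every finite simple graph G on n ≥ N vertices satisfying p₀(G) ≤ ρ − ε and p₃(G) ≤ ρ − ε also satisfies pᵢ(G) ≥ δ for every i ∈ {0,1,2,3}; in particular such a graph contains every 3-vertex graph as an induced subgraph. -/
open Finset

-- `tripleDensity G i` is the probability that a uniformly random 3-element subset of the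
-- vertices of `G` induces a subgraph with exactly `i` edges.
open Classical in
noncomputable def tripleDensity {V : Type} [Fintype V] (G : SimpleGraph V) (i : ℕ) : ℝ :=
  (((univ : Finset V).powersetCard 3).filter
    (fun s => ((s ×ˢ s).filter fun q => G.Adj q.1 q.2).card = 2 * i)).card /
  ((Fintype.card V).choose 3)

section core
variable {V : Type} [Fintype V]

lemma ff_sums (g : V → V → ℝ) (hs : ∀ x y, g x y = g y x) (n E C t3 : ℝ)
    (hn : n = Fintype.card V) (hE : E = ∑ x, ∑ y, g x y)
    (hC : C = ∑ x, ∑ y, ∑ z, g x y * g x z)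
    (ht3 : t3 = ∑ x, ∑ y, ∑ z, g x y * g y z * g x z) :
    (∑ v, ∑ x, ∑ y, (1 - g v x) * g v y * (1 - g x y) = n * E - 2 * C + t3) ∧
    (∑ v, ∑ x, ∑ y, (1 - g v x) * (1 - g v y) * g x y = n * E - 2 * C + t3) ∧
    (∑ x, ∑ y, ∑ z, (1 - g x y) * (1 - g y z) * (1 - g x z)
      = n ^ 3 - 3 * (n * E) + 3 * C - t3) := by
  have h1 : ∑ x, ∑ y, ∑ _z : V, g x y = n * E := by
    simp only [sum_const, nsmul_eq_mul, card_univ, hE, mul_sum, hn]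
  have h2 : ∑ x, ∑ _y : V, ∑ z, g x z = n * E := by
    simp only [sum_const, nsmul_eq_mul, card_univ, hE, mul_sum, hn]
  have h3 : ∑ _x : V, ∑ y, ∑ z, g y z = n * E := by
    simp only [sum_const, nsmul_eq_mul, card_univ, hE, hn]
  have h0 : ∑ _x : V, ∑ _y : V, ∑ _z : V, (1 : ℝ) = n ^ 3 := by
    simp [hn]; ring
  have c1 : ∑ x, ∑ y, ∑ z, g x y * g y z = C := by
    rw [sum_comm, hC]
    refine sum_congr rfl fun y _ => sum_congr rfl fun x _ => sum_congr rfl fun z _ => ?_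
    rw [hs x y]
  have c2 : ∑ x, ∑ y, ∑ z, g x z * g y z = C := by
    rw [← c1]
    refine sum_congr rfl fun x _ => ?_
    rw [sum_comm]
    refine sum_congr rfl fun y _ => sum_congr rfl fun z _ => ?_
    rw [hs z y]
  refine ⟨?_, ?_, ?_⟩
  · have : ∀ v x y, (1 - g v x) * g v y * (1 - g x y)
      = g v y - g v x * g v y - g v y * g x y + g v x * g x y * g v y := by
      intros; ring
    simp only [this, sum_add_distrib, sum_sub_distrib]
    rw [h2, ← hC, c2, ← ht3]; ring
  · have : ∀ v x y, (1 - g v x) * (1 - g v y) * g x y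
      = g x y - g v x * g x y - g v y * g x y + g v x * g x y * g v y := by
      intros; ring
    simp only [this, sum_add_distrib, sum_sub_distrib]
    rw [h3, c1, c2, ← ht3]; ring
  · have : ∀ x y z, (1 - g x y) * (1 - g y z) * (1 - g x z)
      = 1 - g x y - g y z - g x z + g x y * g y z + g x y * g x z + g x z * g y z
        - g x y * g y z * g x z := by
      intros; ring
    simp only [this, sum_add_distrib, sum_sub_distrib]
    rw [h0, h1, h2, h3, c1, c2, ← hC, ← ht3]; ring

lemma ff_goodman (g : V → V → ℝ) (hs : ∀ x y, g x y = g y x) (n t0 t3 : ℝ)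
    (hn : n = Fintype.card V) (hn0 : 0 < n)
    (ht0 : t0 = ∑ x, ∑ y, ∑ z, (1 - g x y) * (1 - g y z) * (1 - g x z))
    (ht3 : t3 = ∑ x, ∑ y, ∑ z, g x y * g y z * g x z) :
    n ^ 3 / 4 ≤ t0 + t3 := by
  obtain ⟨-, -, h⟩ := ff_sums g hs n _ _ t3 hn rfl rfl ht3
  have hC : ∑ x, ∑ y, ∑ z, g x y * g x z = ∑ x, (∑ y, g x y) ^ 2 := by
    refine sum_congr rfl fun x _ => ?_
    rw [sq, sum_mul_sum]
  have hcs := sq_sum_le_card_mul_sum_sq (s := (univ : Finset V)) (f := fun x => ∑ y, g x y)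
  rw [card_univ, ← hn, ← hC] at hcs
  rw [← ht0] at h
  set E := ∑ x, ∑ y, g x y
  set C := ∑ x, ∑ y, ∑ z, g x y * g x z
  have : 0 ≤ n * (t0 + t3 - n ^ 3 / 4) := by
    rw [h]; nlinarith [sq_nonneg (E - n ^ 2 / 2)]
  have := nonneg_of_mul_nonneg_right this hn0
  linarith

lemma ff_vertex (g : V → V → ℝ) (hs : ∀ x y, g x y = g y x) (h01 : ∀ x y, g x y = 0 ∨ g x y = 1)
    (v : V) (n : ℝ) (hn : n = Fintype.card V) :
    3 * (∑ x, (1 - g v x)) * ((∑ x, ∑ y, g x y) - 2 * (∑ x, (1 - g v x)) * (n - ∑ x, (1 - g v x))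
      - ∑ x, ∑ y, (1 - g v x) * (1 - g v y) * g x y)
      - 6 * n * (∑ x, ∑ y, (1 - g v x) * g v y * (1 - g x y))
    ≤ ∑ x, ∑ y, ∑ z, g x y * g y z * g x z := by
  set a := ∑ x, (1 - g v x) with ha
  set E := ∑ x, ∑ y, g x y with hE
  set B2 := ∑ x, ∑ y, (1 - g v x) * (1 - g v y) * g x y with hB2
  set B1 := ∑ x, ∑ y, (1 - g v x) * g v y * (1 - g x y) with hB1
  have ha0 : 0 ≤ a := sum_nonneg fun x _ => by rcases h01 v x with h | h <;> simp [h]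
  have hd : ∑ x, g v x = n - a := by
    simp [ha, hn]
  have h1 : E - 2 * a * (n - a) - B2 ≤ ∑ y, ∑ z, g v y * g v z * g y z := by
    have e1 : ∑ y, ∑ z, (1 - g v y) * g v z = a * (n - a) := by
      rw [← hd, ha, sum_mul_sum]
    have e2 : ∑ y, ∑ z, g v y * (1 - g v z) = a * (n - a) := by
      rw [← hd, ha, mul_comm, sum_mul_sum]
    have : E - a * (n - a) - a * (n - a) - B2 =
      ∑ y, ∑ z, (g y z - (1 - g v y) * g v z - g v y * (1 - g v z)
        - (1 - g v y) * (1 - g v z) * g y z) := by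
      simp only [sum_sub_distrib]; rw [e1, e2]
    have h2 : E - 2 * a * (n - a) - B2 = E - a * (n - a) - a * (n - a) - B2 := by ring
    rw [h2, this]
    refine sum_le_sum fun y _ => sum_le_sum fun z _ => ?_
    rcases h01 v y with h | h <;> rcases h01 v z with h' | h' <;>
      rcases h01 y z with h'' | h'' <;> simp [h, h', h'']
  set Q := ∑ x, ∑ y, ∑ z, (1 - g v x) * g v y * g v z * (g x y * g y z * g x z) with hQ
  have q2 : ∑ x, ∑ y, ∑ z, g v x * (1 - g v y) * g v z * (g x y * g y z * g x z) = Q := by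
    rw [sum_comm, hQ]
    refine sum_congr rfl fun y _ => sum_congr rfl fun x _ => sum_congr rfl fun z _ => ?_
    rw [hs x y]; ring
  have q3 : ∑ x, ∑ y, ∑ z, g v x * g v y * (1 - g v z) * (g x y * g y z * g x z) = Q := by
    rw [← q2]
    refine sum_congr rfl fun x _ => ?_
    rw [sum_comm]
    refine sum_congr rfl fun y _ => sum_congr rfl fun z _ => ?_
    rw [hs z y]; ring
  have h3 : 3 * Q ≤ ∑ x, ∑ y, ∑ z, g x y * g y z * g x z := by
    have : 3 * Q = ∑ x, ∑ y, ∑ z, ((1 - g v x) * g v y * g v z * (g x y * g y z * g x z)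
      + g v x * (1 - g v y) * g v z * (g x y * g y z * g x z)
      + g v x * g v y * (1 - g v z) * (g x y * g y z * g x z)) := by
      simp only [sum_add_distrib]; rw [q2, q3, ← hQ]; ring
    rw [this]
    refine sum_le_sum fun x _ => sum_le_sum fun y _ => sum_le_sum fun z _ => ?_
    have hT : 0 ≤ g x y * g y z * g x z := by
      rcases h01 x y with h | h <;> rcases h01 y z with h' | h' <;>
      rcases h01 x z with h'' | h'' <;> simp [h, h', h'']
    rcases h01 v x with h | h <;> rcases h01 v y with h' | h' <;>
      rcases h01 v z with h'' | h'' <;> simp [h, h', h'', hT]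
  have h4 : a * (∑ y, ∑ z, g v y * g v z * g y z) - n * B1 - n * B1 ≤ Q := by
    have e1 : ∑ x, ∑ y, ∑ z, (1 - g v x) * (g v y * g v z * g y z)
        = a * (∑ y, ∑ z, g v y * g v z * g y z) := by
      rw [ha, sum_mul]; simp only [mul_sum]
    have e2 : ∑ x, ∑ y, ∑ _z : V, (1 - g v x) * g v y * (1 - g x y) = n * B1 := by
      simp only [sum_const, nsmul_eq_mul, card_univ, hB1, mul_sum, hn]
    have e3 : ∑ x, ∑ _y : V, ∑ z, (1 - g v x) * g v z * (1 - g x z) = n * B1 := by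
      simp only [sum_const, nsmul_eq_mul, card_univ, hB1, mul_sum, hn]
    rw [← e1]
    nth_rewrite 1 [← e2]
    rw [← e3, hQ]
    simp only [← sum_sub_distrib]
    refine sum_le_sum fun x _ => sum_le_sum fun y _ => sum_le_sum fun z _ => ?_
    rcases h01 v x with h | h <;> rcases h01 v y with h' | h' <;>
      rcases h01 v z with h'' | h'' <;> rcases h01 x y with k | k <;>
      rcases h01 x z with k' | k' <;> rcases h01 y z with k'' | k'' <;>
      norm_num [h, h', h'', k, k', k'']
  have h5 := mul_le_mul_of_nonneg_left h1 ha0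
  linarith

lemma ff_core (θ ρ ε : ℝ) (hθ : θ ^ 3 + θ ^ 2 - θ + 1 / 6 = 0) (hlo : 0.42 ≤ θ) (hhi : θ ≤ 0.43)
    (hρ : ρ = 6 * θ ^ 2 * (1 - 2 * θ)) (hρ' : ρ ≤ 0.18) (hε : 0 < ε)
    (g : V → V → ℝ) (hs : ∀ x y, g x y = g y x) (h01 : ∀ x y, g x y = 0 ∨ g x y = 1)
    (n t0 t3 B : ℝ) (hn : n = Fintype.card V) (hn0 : 0 < n)
    (ht0 : t0 = ∑ x, ∑ y, ∑ z, (1 - g x y) * (1 - g y z) * (1 - g x z))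
    (ht3 : t3 = ∑ x, ∑ y, ∑ z, g x y * g y z * g x z)
    (hB : B = ∑ v, ∑ x, ∑ y, (1 - g v x) * g v y * (1 - g x y))
    (k0 : t0 ≤ (ρ - ε + ε / 240) * n ^ 3) (k3 : t3 ≤ (ρ - ε) * n ^ 3)
    (kB : B ≤ ε / 240 * n ^ 3) : False := by
  obtain ⟨s1, s2, s3⟩ := ff_sums g hs n _ _ t3 hn rfl rfl ht3
  rw [← hB] at s1
  rw [← ht0] at s3
  have s2' := s2.trans s1.symm
  set E := ∑ x, ∑ y, g x y with hE
  set C := ∑ x, ∑ y, ∑ z, g x y * g x z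
  have hg0 : ∀ x y, 0 ≤ g x y := fun x y => by rcases h01 x y with h | h <;> simp [h]
  have hg1 : ∀ x y, 0 ≤ 1 - g x y := fun x y => by rcases h01 x y with h | h <;> simp [h]
  have t0nn : 0 ≤ t0 := by
    rw [ht0]
    exact sum_nonneg fun x _ => sum_nonneg fun y _ => sum_nonneg fun z _ =>
      mul_nonneg (mul_nonneg (hg1 _ _) (hg1 _ _)) (hg1 _ _)
  have Bnn : 0 ≤ B := by
    rw [hB]
    exact sum_nonneg fun x _ => sum_nonneg fun y _ => sum_nonneg fun z _ =>
      mul_nonneg (mul_nonneg (hg1 _ _) (hg0 _ _)) (hg1 _ _)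
  have hnE : 3 * (n * E) = 2 * n ^ 3 - 2 * t0 + t3 - 3 * B := by linarith
  have hn3 : 0 < n ^ 3 := by positivity
  -- choose a vertex
  obtain ⟨v, hv⟩ : ∃ v, 0 < n * (∑ x, (1 - g v x)) - (1 - 2 * θ) * n ^ 2
      - 12 / ε * ((∑ x, ∑ y, (1 - g v x) * g v y * (1 - g x y))
        + ∑ x, ∑ y, (1 - g v x) * (1 - g v y) * g x y) := by
    by_contra hcon
    push Not at hcon
    have := sum_nonpos fun v (_ : v ∈ (univ : Finset V)) => hcon v
    simp only [sum_sub_distrib, ← mul_sum, sum_add_distrib] at this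
    rw [s2', ← hB, ← hE] at this
    simp only [sum_const, nsmul_eq_mul, card_univ, ← hn, mul_one] at this
    have e1 : 12 / ε * (B + B) ≤ 12 / ε * (ε / 240 * n ^ 3 + ε / 240 * n ^ 3) := by gcongr
    have e2 : 12 / ε * (ε / 240 * n ^ 3 + ε / 240 * n ^ 3) = n ^ 3 / 10 := by
      field_simp; norm_num
    have e3 : (1 - 2 * θ) * n ^ 3 ≤ 0.16 * n ^ 3 := by gcongr; linarith
    have e4 : (ρ - ε) * n ^ 3 ≤ 0.18 * n ^ 3 := by gcongr; linarith
    nlinarith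
  have key := ff_vertex g hs h01 v n hn
  rw [← ht3, ← hE] at key
  set a := ∑ x, (1 - g v x) with ha
  set B1 := ∑ x, ∑ y, (1 - g v x) * g v y * (1 - g x y)
  set B2 := ∑ x, ∑ y, (1 - g v x) * (1 - g v y) * g x y
  have B1nn : 0 ≤ B1 := sum_nonneg fun y _ => sum_nonneg fun z _ =>
      mul_nonneg (mul_nonneg (hg1 _ _) (hg0 _ _)) (hg1 _ _)
  have B2nn : 0 ≤ B2 := sum_nonneg fun y _ => sum_nonneg fun z _ =>
      mul_nonneg (mul_nonneg (hg1 _ _) (hg1 _ _)) (hg0 _ _)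
  have hann : 0 ≤ a := sum_nonneg fun _ _ => hg1 _ _
  have han : a ≤ n := by
    have : ∑ x, (1 - g v x) ≤ ∑ _x : V, (1 : ℝ) := sum_le_sum fun x _ => by linarith [hg0 v x]
    have h2 : ∑ _x : V, (1 : ℝ) = n := by simp [hn]
    rw [h2] at this; exact this
  -- bounds
  have hat : (1 - 2 * θ) * n ≤ a := by
    have : 0 ≤ 12 / ε * (B1 + B2) := by positivity
    have : 0 < n * (a - (1 - 2 * θ) * n) := by nlinarith
    have := pos_of_mul_pos_right this hn0.le
    linarith
  have hBB : B1 + B2 ≤ ε / 12 * n ^ 2 := by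
    have h1 : 12 / ε * (B1 + B2) ≤ n ^ 2 := by nlinarith [sq_nonneg n]
    calc B1 + B2 = ε / 12 * (12 / ε * (B1 + B2)) := by field_simp
      _ ≤ _ := by gcongr
  set α := a / n with hα
  have haα : a = α * n := by rw [hα]; field_simp
  have hα0 : 0 ≤ α := by positivity
  have hα1 : α ≤ 1 := by rw [hα, div_le_one hn0]; exact han
  have hαt : 1 - 2 * θ ≤ α := by rw [hα, le_div_iff₀ hn0]; exact hat
  have f1 : a * B2 ≤ n * B2 := mul_le_mul_of_nonneg_right han B2nn
  have f2 : n * (B1 + B2) ≤ n * (ε / 12 * n ^ 2) := mul_le_mul_of_nonneg_left hBB hn0.le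
  have f3 : 3 * a * E - 6 * a ^ 2 * (n - a) - ε / 2 * n ^ 3 ≤ t3 := by
    have : 0 ≤ n * B2 := by positivity
    linarith
  have f4 : 3 * a * E = α * (2 * n ^ 3 - 2 * t0 + t3 - 3 * B) := by rw [← hnE, haα]; ring
  have f5 : 6 * a ^ 2 * (n - a) = 6 * α ^ 2 * (1 - α) * n ^ 3 := by rw [haα]; ring
  rw [f4, f5] at f3
  have f6 : α * t0 ≤ α * ((ρ - ε + ε / 240) * n ^ 3) := mul_le_mul_of_nonneg_left k0 hα0
  have f7 : α * B ≤ α * (ε / 240 * n ^ 3) := mul_le_mul_of_nonneg_left kB hα0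
  have f8 : (1 - α) * t3 ≤ (1 - α) * ((ρ - ε) * n ^ 3) :=
    mul_le_mul_of_nonneg_left k3 (by linarith)
  have f9 : (α * (2 - 2 * (ρ - ε + ε / 240) - 3 * (ε / 240)) - 6 * α ^ 2 * (1 - α) - ε / 2
      - (1 - α) * (ρ - ε)) * n ^ 3 ≤ 0 := by linarith
  have f10 : α * (2 - 2 * (ρ - ε + ε / 240) - 3 * (ε / 240)) - 6 * α ^ 2 * (1 - α) - ε / 2
      - (1 - α) * (ρ - ε) ≤ 0 := by
    by_contra h
    push Not at h
    have := mul_pos h hn3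
    linarith
  have f11 : 6 * ((α - θ) ^ 2 * (α - (1 - 2 * θ))) =
      6 * α ^ 3 - 6 * α ^ 2 + (2 - ρ) * α - ρ := by
    rw [hρ]; linear_combination (-12 * α) * hθ
  have f12 : 0 ≤ (α - θ) ^ 2 * (α - (1 - 2 * θ)) := mul_nonneg (sq_nonneg _) (by linarith)
  have f13 : 0 ≤ α * ε := by positivity
  linarith

end core

section counting
variable {V : Type} [Fintype V]

open Classical in
lemma ff_cnt (P : Finset V → Prop) [DecidablePred P] :
    ((univ : Finset (V × V × V)).filter (fun q => (q.1 ≠ q.2.1 ∧ q.2.1 ≠ q.2.2 ∧ q.1 ≠ q.2.2) ∧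
      P {q.1, q.2.1, q.2.2})).card = 6 * (((univ : Finset V).powersetCard 3).filter P).card := by
  have hmaps : ∀ q ∈ (univ : Finset (V × V × V)).filter
      (fun q => (q.1 ≠ q.2.1 ∧ q.2.1 ≠ q.2.2 ∧ q.1 ≠ q.2.2) ∧ P {q.1, q.2.1, q.2.2}),
      ({q.1, q.2.1, q.2.2} : Finset V) ∈ ((univ : Finset V).powersetCard 3).filter P := by
    rintro ⟨x, y, z⟩ hq
    simp only [mem_filter, mem_univ, true_and] at hq
    simp only [mem_filter, mem_powersetCard, subset_univ, true_and]
    exact ⟨card_eq_three.2 ⟨x, y, z, hq.1.1, hq.1.2.2, hq.1.2.1, rfl⟩, hq.2⟩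
  rw [card_eq_sum_card_fiberwise hmaps, mul_comm, ← smul_eq_mul, ← sum_const]
  refine sum_congr rfl fun s hs => ?_
  simp only [mem_filter, mem_powersetCard, subset_univ, true_and] at hs
  obtain ⟨a, b, c, hab, hac, hbc, rfl⟩ := card_eq_three.1 hs.1
  have : ((univ : Finset (V × V × V)).filter
      (fun q => (q.1 ≠ q.2.1 ∧ q.2.1 ≠ q.2.2 ∧ q.1 ≠ q.2.2) ∧ P {q.1, q.2.1, q.2.2})).filter
      (fun q => ({q.1, q.2.1, q.2.2} : Finset V) = {a, b, c}) =
      {(a, b, c), (a, c, b), (b, a, c), (b, c, a), (c, a, b), (c, b, a)} := by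
    ext ⟨x, y, z⟩
    simp only [mem_filter, mem_univ, true_and, mem_insert, mem_singleton, Prod.mk.injEq]
    constructor
    · rintro ⟨⟨⟨h1, h2, h3⟩, -⟩, h⟩
      have hx : x ∈ ({a, b, c} : Finset V) := by rw [← h]; simp
      have hy : y ∈ ({a, b, c} : Finset V) := by rw [← h]; simp
      have hz : z ∈ ({a, b, c} : Finset V) := by rw [← h]; simp
      simp only [mem_insert, mem_singleton] at hx hy hz
      grind
    · intro h
      have e : ({x, y, z} : Finset V) = {a, b, c} := by
        ext w; simp only [mem_insert, mem_singleton]; grind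
      rw [e]
      exact ⟨⟨by grind, hs.2⟩, rfl⟩
  rw [this]
  have hab' := hab.symm
  have hac' := hac.symm
  have hbc' := hbc.symm
  simp [hab, hac, hbc, hab', hac', hbc', card_insert_of_notMem]

open Classical in
lemma ff_edges (G : SimpleGraph V) (x y z : V) (hxy : x ≠ y) (hyz : y ≠ z) (hxz : x ≠ z) :
    ((({x, y, z} : Finset V) ×ˢ ({x, y, z} : Finset V)).filter fun q => G.Adj q.1 q.2).card
    = 2 * ((if G.Adj x y then 1 else 0) + (if G.Adj y z then 1 else 0)
      + (if G.Adj x z then 1 else 0)) := by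
  rw [card_filter, sum_product]
  simp only [sum_insert, mem_insert, mem_singleton, hxy, hyz, hxz, or_self, not_false_eq_true,
    sum_singleton, G.irrefl, G.adj_comm y x, G.adj_comm z x, G.adj_comm z y, if_false]
  ring

open Classical in
lemma ff_dens (G : SimpleGraph V) (i : ℕ) (n : ℝ) (hn : n = Fintype.card V) (hn3 : 3 ≤ n) :
    tripleDensity G i * (n * (n - 1) * (n - 2)) = ∑ x, ∑ y, ∑ z,
      if (x ≠ y ∧ y ≠ z ∧ x ≠ z) ∧ ((if G.Adj x y then 1 else 0) + (if G.Adj y z then 1 else 0)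
      + (if G.Adj x z then 1 else 0)) = i then (1 : ℝ) else 0 := by
  have hc : ((Fintype.card V).choose 3 : ℝ) * 6 = n * (n - 1) * (n - 2) := by
    have h3 : 3 ≤ Fintype.card V := by rw [hn] at hn3; exact_mod_cast hn3
    obtain ⟨m, hm⟩ := Nat.exists_eq_add_of_le h3
    have h1 := Nat.descFactorial_eq_factorial_mul_choose (Fintype.card V) 3
    have h2 : ((Fintype.card V).descFactorial 3 : ℝ) = n * (n - 1) * (n - 2) := by
      rw [hn, hm]
      have e1 : 3 + m - 2 = m + 1 := by omega
      have e2 : 3 + m - 1 = m + 2 := by omega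
      simp only [Nat.descFactorial_succ, Nat.descFactorial_zero, e1, e2]
      push_cast; simp; ring
    rw [← h2, h1]
    simp [Nat.factorial]; ring
  have hpos : (0 : ℝ) < ((Fintype.card V).choose 3 : ℝ) := by
    have : 0 < n * (n - 1) * (n - 2) := mul_pos (mul_pos (by linarith) (by linarith)) (by linarith)
    linarith
  have key := ff_cnt (V := V) (fun s => ((s ×ˢ s).filter fun q => G.Adj q.1 q.2).card = 2 * i)
  have key2 : (((univ : Finset V).powersetCard 3).filter
    (fun s => ((s ×ˢ s).filter fun q => G.Adj q.1 q.2).card = 2 * i)).card * (6 : ℝ)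
      = ∑ x, ∑ y, ∑ z,
      if (x ≠ y ∧ y ≠ z ∧ x ≠ z) ∧ ((if G.Adj x y then 1 else 0) + (if G.Adj y z then 1 else 0)
      + (if G.Adj x z then 1 else 0)) = i then (1 : ℝ) else 0 := by
    have : (((univ : Finset V).powersetCard 3).filter
    (fun s => ((s ×ˢ s).filter fun q => G.Adj q.1 q.2).card = 2 * i)).card * (6 : ℝ) =
      ((6 * (((univ : Finset V).powersetCard 3).filter
    (fun s => ((s ×ˢ s).filter fun q => G.Adj q.1 q.2).card = 2 * i)).card : ℕ) : ℝ) := by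
      push_cast; ring
    rw [this, ← key, card_filter]
    push_cast
    rw [Fintype.sum_prod_type]
    refine sum_congr rfl fun x _ => ?_
    rw [Fintype.sum_prod_type]
    refine sum_congr rfl fun y _ => sum_congr rfl fun z _ => ?_
    refine if_congr ?_ rfl rfl
    refine and_congr_right fun h => ?_
    rw [ff_edges G x y z h.1 h.2.1 h.2.2]
    simp
  rw [← key2, ← hc, tripleDensity]
  field_simp

open Classical in
lemma ff_compl (G : SimpleGraph V) (i j : ℕ) (hij : i + j = 3) :
    tripleDensity Gᶜ i = tripleDensity G j := by
  unfold tripleDensity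
  congr 3
  refine filter_congr fun s hs => ?_
  rw [mem_powersetCard] at hs
  obtain ⟨a, b, c, hab, hac, hbc, rfl⟩ := card_eq_three.1 hs.2
  rw [ff_edges G a b c hab hbc hac, ff_edges Gᶜ a b c hab hbc hac]
  simp only [SimpleGraph.compl_adj, hab, hbc, hac, ne_eq, not_false_eq_true, true_and]
  split_ifs <;> grind

open Classical in
lemma ff_exists (G : SimpleGraph V) (i : ℕ) (h : 0 < tripleDensity G i) :
    ∃ x y z : V, x ≠ y ∧ y ≠ z ∧ x ≠ z ∧ ((if G.Adj x y then 1 else 0)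
      + (if G.Adj y z then 1 else 0) + (if G.Adj x z then 1 else 0)) = i := by
  by_contra hcon
  have : (((univ : Finset V).powersetCard 3).filter
    (fun s => ((s ×ˢ s).filter fun q => G.Adj q.1 q.2).card = 2 * i)) = ∅ := by
    rw [filter_eq_empty_iff]
    intro s hs h2
    rw [mem_powersetCard] at hs
    obtain ⟨a, b, c, hab, hac, hbc, rfl⟩ := card_eq_three.1 hs.2
    rw [ff_edges G a b c hab hbc hac] at h2
    exact hcon ⟨a, b, c, hab, hbc, hac, by omega⟩
  rw [tripleDensity, this] at h
  simp at h

lemma ff_mk (G : SimpleGraph V) (H : SimpleGraph (Fin 3)) (x y z : V) (hxy : x ≠ y) (hyz : y ≠ z)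
    (hxz : x ≠ z) (h1 : H.Adj 0 1 ↔ G.Adj x y) (h2 : H.Adj 1 2 ↔ G.Adj y z)
    (h3 : H.Adj 0 2 ↔ G.Adj x z) : ∃ f : Fin 3 → V, Function.Injective f ∧
            ∀ i j : Fin 3, H.Adj i j ↔ G.Adj (f i) (f j) := by
  refine ⟨![x, y, z], ?_, ?_⟩
  · intro i j hij
    fin_cases i <;> fin_cases j <;> simp_all [eq_comm]
  · intro i j
    fin_cases i <;> fin_cases j <;> simp [h1, h2, h3, H.adj_comm 1 0, H.adj_comm 2 0,
      H.adj_comm 2 1, G.adj_comm y x, G.adj_comm z y, G.adj_comm z x]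

open Classical in
lemma ff_universal (G : SimpleGraph V) (h : ∀ i : ℕ, i ≤ 3 → 0 < tripleDensity G i)
    (H : SimpleGraph (Fin 3)) : ∃ f : Fin 3 → V, Function.Injective f ∧
            ∀ i j : Fin 3, H.Adj i j ↔ G.Adj (f i) (f j) := by
  obtain ⟨x, y, z, hxy, hyz, hxz, he⟩ := ff_exists G
    ((if H.Adj 0 1 then 1 else 0) + (if H.Adj 1 2 then 1 else 0)
      + (if H.Adj 0 2 then 1 else 0)) (h _ (by split_ifs <;> omega))
  have s1 := G.adj_comm x y
  have s2 := G.adj_comm y z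
  have s3 := G.adj_comm x z
  have key : ((H.Adj 0 1 ↔ G.Adj x y) ∧ (H.Adj 1 2 ↔ G.Adj y z) ∧ (H.Adj 0 2 ↔ G.Adj x z)) ∨
    ((H.Adj 0 1 ↔ G.Adj x z) ∧ (H.Adj 1 2 ↔ G.Adj z y) ∧ (H.Adj 0 2 ↔ G.Adj x y)) ∨
    ((H.Adj 0 1 ↔ G.Adj y x) ∧ (H.Adj 1 2 ↔ G.Adj x z) ∧ (H.Adj 0 2 ↔ G.Adj y z)) ∨
    ((H.Adj 0 1 ↔ G.Adj y z) ∧ (H.Adj 1 2 ↔ G.Adj z x) ∧ (H.Adj 0 2 ↔ G.Adj y x)) ∨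
    ((H.Adj 0 1 ↔ G.Adj z x) ∧ (H.Adj 1 2 ↔ G.Adj x y) ∧ (H.Adj 0 2 ↔ G.Adj z y)) ∨
    ((H.Adj 0 1 ↔ G.Adj z y) ∧ (H.Adj 1 2 ↔ G.Adj y x) ∧ (H.Adj 0 2 ↔ G.Adj z x)) := by
    by_cases a1 : H.Adj 0 1 <;> by_cases a2 : H.Adj 1 2 <;> by_cases a3 : H.Adj 0 2 <;>
    by_cases b1 : G.Adj x y <;> by_cases b2 : G.Adj y z <;> by_cases b3 : G.Adj x z <;>
    simp_all
  rcases key with k | k | k | k | k | k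
  · exact ff_mk G H x y z hxy hyz hxz k.1 k.2.1 k.2.2
  · exact ff_mk G H x z y hxz hyz.symm hxy k.1 k.2.1 k.2.2
  · exact ff_mk G H y x z hxy.symm hxz hyz k.1 k.2.1 k.2.2
  · exact ff_mk G H y z x hyz hxz.symm hxy.symm k.1 k.2.1 k.2.2
  · exact ff_mk G H z x y hxz.symm hxy hyz.symm k.1 k.2.1 k.2.2
  · exact ff_mk G H z y x hyz.symm hxy.symm hxz.symm k.1 k.2.1 k.2.2

open Classical in
/-- real adjacency indicator -/
noncomputable def ffg (G : SimpleGraph V) (x y : V) : ℝ := if G.Adj x y then 1 else 0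

lemma ff_bridge (G : SimpleGraph V) (n : ℝ) (hn : n = Fintype.card V) (hn3 : 3 ≤ n) :
    (∑ x, ∑ y, ∑ z, ffg G x y * ffg G y z * ffg G x z
      = tripleDensity G 3 * (n * (n - 1) * (n - 2))) ∧
    (∑ x, ∑ y, ∑ z, (1 - ffg G x y) * (1 - ffg G y z) * (1 - ffg G x z)
      ≤ tripleDensity G 0 * (n * (n - 1) * (n - 2)) + 3 * n ^ 2) ∧
    (3 * ∑ v, ∑ x, ∑ y, (1 - ffg G v x) * ffg G v y * (1 - ffg G x y)
      = tripleDensity G 1 * (n * (n - 1) * (n - 2))) := by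
  classical
  have hs : ∀ x y, ffg G x y = ffg G y x := fun x y => by simp [ffg, G.adj_comm]
  rw [ff_dens G 3 n hn hn3, ff_dens G 0 n hn hn3, ff_dens G 1 n hn hn3]
  refine ⟨?_, ?_, ?_⟩
  · refine sum_congr rfl fun x _ => sum_congr rfl fun y _ => sum_congr rfl fun z _ => ?_
    by_cases a1 : G.Adj x y <;> by_cases a2 : G.Adj y z <;> by_cases a3 : G.Adj x z <;>
      simp [ffg, a1, a2, a3]
    exact ⟨a1.ne, a2.ne, a3.ne⟩
  · have d1 : ∑ x : V, ∑ y : V, ∑ _z : V, (if x = y then (1 : ℝ) else 0) = n ^ 2 := by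
      simp [hn]; ring
    have d2 : ∑ x : V, ∑ _y : V, ∑ z : V, (if x = z then (1 : ℝ) else 0) = n ^ 2 := by
      simp [hn]; ring
    have d3 : ∑ _x : V, ∑ y : V, ∑ z : V, (if y = z then (1 : ℝ) else 0) = n ^ 2 := by
      simp [hn]; ring
    have d4 : 3 * n ^ 2 = n ^ 2 + n ^ 2 + n ^ 2 := by ring
    rw [d4]
    nth_rewrite 1 [← d1]
    nth_rewrite 1 [← d2]
    rw [← d3]
    simp only [← sum_add_distrib]
    refine sum_le_sum fun x _ => sum_le_sum fun y _ => sum_le_sum fun z _ => ?_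
    have hle : (1 - ffg G x y) * (1 - ffg G y z) * (1 - ffg G x z) ≤ 1 := by
      by_cases a1 : G.Adj x y <;> by_cases a2 : G.Adj y z <;> by_cases a3 : G.Adj x z <;>
        simp [ffg, a1, a2, a3]
    have i1 : ∀ (p : Prop) [Decidable p], (0 : ℝ) ≤ if p then 1 else 0 := fun p _ => by split_ifs <;> norm_num
    have j1 := i1 (x = y)
    have j2 := i1 (x = z)
    have j3 := i1 (y = z)
    by_cases b1 : x = y
    · rw [if_pos b1] at j1 ⊢
      refine le_trans hle (le_trans ?_ (le_add_of_nonneg_left (i1 _)))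
      linarith
    by_cases b2 : y = z
    · rw [if_pos b2] at j3 ⊢
      refine le_trans hle (le_trans ?_ (le_add_of_nonneg_left (i1 _)))
      linarith
    by_cases b3 : x = z
    · rw [if_pos b3] at j2 ⊢
      refine le_trans hle (le_trans ?_ (le_add_of_nonneg_left (i1 _)))
      linarith
    by_cases a1 : G.Adj x y <;> by_cases a2 : G.Adj y z <;> by_cases a3 : G.Adj x z <;>
      simp [ffg, a1, a2, a3, b1, b2, b3]
  · set B := ∑ v, ∑ x, ∑ y, (1 - ffg G v x) * ffg G v y * (1 - ffg G x y) with hB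
    have q2 : ∑ x, ∑ y, ∑ z, (1 - ffg G x y) * ffg G y z * (1 - ffg G x z) = B := by
      rw [sum_comm, hB]
      refine sum_congr rfl fun y _ => sum_congr rfl fun x _ => sum_congr rfl fun z _ => ?_
      rw [hs x y]
    have q3 : ∑ x, ∑ y, ∑ z, ffg G x y * (1 - ffg G y z) * (1 - ffg G x z) = B := by
      rw [hB]
      refine sum_congr rfl fun x _ => ?_
      rw [sum_comm]
      refine sum_congr rfl fun y _ => sum_congr rfl fun z _ => ?_
      rw [hs z y]; ring
    have e : 3 * B = B + B + B := by ring
    rw [e]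
    nth_rewrite 1 [hB]
    nth_rewrite 1 [← q2]
    rw [← q3]
    simp only [← sum_add_distrib]
    refine sum_congr rfl fun x _ => sum_congr rfl fun y _ => sum_congr rfl fun z _ => ?_
    by_cases b1 : x = y
    · subst b1
      by_cases a2 : G.Adj x z <;> simp [ffg, a2]
    by_cases b2 : y = z
    · subst b2
      by_cases a2 : G.Adj x y <;> simp [ffg, a2]
    by_cases b3 : x = z
    · subst b3
      by_cases a2 : G.Adj x y <;> simp [ffg, a2, G.adj_comm y x]
    by_cases a1 : G.Adj x y <;> by_cases a2 : G.Adj y z <;> by_cases a3 : G.Adj x z <;>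
      simp [ffg, a1, a2, a3, b1, b2, b3]

end counting

section final
variable {V : Type} [Fintype V]

lemma ff_nonneg (G : SimpleGraph V) (i : ℕ) : 0 ≤ tripleDensity G i := by
  unfold tripleDensity; positivity

lemma ff_p1 (θ ρ ε : ℝ) (hθ : θ ^ 3 + θ ^ 2 - θ + 1 / 6 = 0) (hlo : 0.42 ≤ θ) (hhi : θ ≤ 0.43)
    (hρ : ρ = 6 * θ ^ 2 * (1 - 2 * θ)) (hρ' : ρ ≤ 0.18) (hε : 0 < ε)
    (G : SimpleGraph V) (n : ℝ) (hn : n = Fintype.card V) (hn3 : 3 ≤ n) (hnε : 720 / ε ≤ n)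
    (h0 : tripleDensity G 0 ≤ ρ - ε) (h3 : tripleDensity G 3 ≤ ρ - ε) :
    ε / 240 ≤ tripleDensity G 1 := by
  by_contra hcon
  push Not at hcon
  obtain ⟨b3, b0, b1⟩ := ff_bridge G n hn hn3
  have hM : n * (n - 1) * (n - 2) ≤ n ^ 3 := by nlinarith
  have hM0 : 0 ≤ n * (n - 1) * (n - 2) :=
    mul_nonneg (mul_nonneg (by linarith) (by linarith)) (by linarith)
  have hmul : ∀ p q : ℝ, 0 ≤ p → p ≤ q → p * (n * (n - 1) * (n - 2)) ≤ q * n ^ 3 :=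
    fun p q hp hpq => mul_le_mul hpq hM hM0 (hp.trans hpq)
  have m0 := hmul _ _ (ff_nonneg G 0) h0
  have m3 := hmul _ _ (ff_nonneg G 3) h3
  have m1 := hmul _ _ (ff_nonneg G 1) hcon.le
  have hn2 : 3 * n ^ 2 ≤ ε / 240 * n ^ 3 := by
    rw [div_le_iff₀ hε] at hnε
    nlinarith [sq_nonneg n]
  have hn3' : 0 ≤ ε / 240 * n ^ 3 := by positivity
  refine ff_core θ ρ ε hθ hlo hhi hρ hρ' hε (ffg G) (fun x y => by unfold ffg; rw [G.adj_comm])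
    (fun x y => by unfold ffg; split_ifs <;> simp) n _ _ _ hn (by linarith) rfl rfl rfl ?_ ?_ ?_
  · linarith
  · linarith
  · linarith

lemma ff_good (G : SimpleGraph V) (n : ℝ) (hn : n = Fintype.card V) (hn3 : 100 ≤ n) :
    0.22 ≤ tripleDensity G 0 + tripleDensity G 3 := by
  obtain ⟨b3, b0, -⟩ := ff_bridge G n hn (by linarith)
  have hM : n * (n - 1) * (n - 2) ≤ n ^ 3 := by nlinarith
  have g := ff_goodman (ffg G) (fun x y => by unfold ffg; rw [G.adj_comm]) n _ _ hn (by linarith)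
    rfl rfl
  have m := mul_le_mul_of_nonneg_left hM (add_nonneg (ff_nonneg G 0) (ff_nonneg G 3))
  have hn2 : 3 * n ^ 2 ≤ 0.03 * n ^ 3 := by nlinarith [sq_nonneg n]
  have hp : 0 < n ^ 3 := by positivity
  have : 0.22 * n ^ 3 ≤ (tripleDensity G 0 + tripleDensity G 3) * n ^ 3 := by linarith
  exact le_of_mul_le_mul_right this hp

end final

/-- Graphs with few 3-cliques and 3-anticliques are 3-universal, with the sharp constant
`ρ = 6θ²(1-2θ)` where `θ` is the largest real root of `x³ + x² - x + 1/6 = 0`. -/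
theorem few_triangles_and_antitriangles_implies_three_universal :
    ∃ θ ρ : ℝ,
      θ ^ 3 + θ ^ 2 - θ + 1 / 6 = 0 ∧
      (∀ x : ℝ, x ^ 3 + x ^ 2 - x + 1 / 6 = 0 → x ≤ θ) ∧
      ρ = 6 * θ ^ 2 * (1 - 2 * θ) ∧
      ∀ ε : ℝ, 0 < ε → ∃ δ : ℝ, 0 < δ ∧ ∃ N : ℕ,
        ∀ (V : Type) [Fintype V] (G : SimpleGraph V),
          N ≤ Fintype.card V →
          tripleDensity G 0 ≤ ρ - ε → tripleDensity G 3 ≤ ρ - ε →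
          (∀ i : ℕ, i ≤ 3 → δ ≤ tripleDensity G i) ∧
          (∀ H : SimpleGraph (Fin 3), ∃ f : Fin 3 → V, Function.Injective f ∧
            ∀ i j : Fin 3, H.Adj i j ↔ G.Adj (f i) (f j)) := by
  obtain ⟨θ, ⟨hlo, hhi⟩, hθ⟩ : ∃ θ ∈ Set.Icc (0.42 : ℝ) 0.43,
      θ ^ 3 + θ ^ 2 - θ + 1 / 6 = 0 := by
    have hcont : ContinuousOn (fun x : ℝ => x ^ 3 + x ^ 2 - x + 1 / 6) (Set.Icc 0.42 0.43) := by
      fun_prop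
    have := intermediate_value_Icc (by norm_num : (0.42 : ℝ) ≤ 0.43) hcont
    have h0 : (0 : ℝ) ∈ Set.Icc ((0.42 : ℝ) ^ 3 + 0.42 ^ 2 - 0.42 + 1 / 6)
        (0.43 ^ 3 + 0.43 ^ 2 - 0.43 + 1 / 6) := by constructor <;> norm_num
    obtain ⟨x, hx, h⟩ := this h0
    exact ⟨x, hx, h⟩
  have hρ' : 6 * θ ^ 2 * (1 - 2 * θ) ≤ 0.18 := by
    have h1 : θ ^ 2 ≤ 0.43 ^ 2 := by gcongr
    have h2 : θ ^ 2 * (1 - 2 * θ) ≤ 0.43 ^ 2 * 0.16 :=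
      mul_le_mul h1 (by linarith) (by linarith) (by norm_num)
    norm_num at h2 ⊢
    linarith
  refine ⟨θ, _, hθ, ?_, rfl, ?_⟩
  · intro x hx
    by_contra hlt
    push Not at hlt
    have h1 : (x - θ) * (x ^ 2 + x * θ + θ ^ 2 + x + θ - 1) = 0 := by linarith
    have h2 : 0 < x ^ 2 + x * θ + θ ^ 2 + x + θ - 1 := by nlinarith
    have := mul_pos (sub_pos.2 hlt) h2
    linarith
  intro ε hε
  refine ⟨min (ε / 240) 0.01, by positivity, max 100 ⌈720 / ε⌉₊, ?_⟩
  intro V _ G hN h0 h3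
  obtain ⟨n, hn⟩ : ∃ n : ℝ, n = (Fintype.card V : ℝ) := ⟨_, rfl⟩
  have hn100 : 100 ≤ n := by
    have : 100 ≤ Fintype.card V := (le_max_left _ _).trans hN
    rw [hn]; exact_mod_cast this
  have hnε : 720 / ε ≤ n := by
    rw [hn]; exact Nat.ceil_le.1 ((le_max_right _ _).trans hN)
  have hall : ∀ i : ℕ, i ≤ 3 → min (ε / 240) 0.01 ≤ tripleDensity G i := by
    have g := ff_good G n hn hn100
    have p1 := ff_p1 θ _ ε hθ hlo hhi rfl hρ' hε G n hn (by linarith) hnε h0 h3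
    have p2 := ff_p1 θ _ ε hθ hlo hhi rfl hρ' hε Gᶜ n hn (by linarith) hnε
      (by rw [ff_compl G 0 3 rfl]; exact h3) (by rw [ff_compl G 3 0 rfl]; exact h0)
    rw [ff_compl G 1 2 rfl] at p2
    intro i hi
    interval_cases i
    · exact (min_le_right _ _).trans (by linarith)
    · exact (min_le_left _ _).trans p1
    · exact (min_le_left _ _).trans p2
    · exact (min_le_right _ _).trans (by linarith)
  have hpos : 0 < min (ε / 240) (0.01 : ℝ) := by positivity
  exact ⟨hall, fun H => ff_universal G (fun i hi => hpos.trans_le (hall i hi)) H⟩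
end

section
/- The constant ρ in the main theorem is tight: for every ε > 0 and every M ∈ ℕ there exists a finite simple graph G on n ≥ M vertices such that G contains no induced path on 3 vertices (equivalently p₂(G) = 0), |p₀(G) − ρ| ≤ ε and |p₃(G) − ρ| ≤ ε. (Such a graph is obtained as the disjoint union of two cliques of size ⌊θn⌋ together with isolated vertices.) -/
open Finset

open Filter Topology

/-- The disjoint union of cliques given by the fibres of a colouring. -/
def colG {V : Type} (c : V → Fin 3) : SimpleGraph V where
  Adj u v := u ≠ v ∧ c u = c v
  symm := ⟨fun _ _ h => ⟨h.1.symm, h.2.symm⟩⟩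
  loopless := ⟨fun _ h => h.1 rfl⟩

open Classical in
lemma colG_edges {V : Type} (c : V → Fin 3) {x y z : V} (hxy : x ≠ y) (hxz : x ≠ z)
    (hyz : y ≠ z) :
    (((({x, y, z} : Finset V) ×ˢ ({x, y, z} : Finset V))).filter
      fun q => (colG c).Adj q.1 q.2).card =
    2 * ((if c x = c y then 1 else 0) + (if c x = c z then 1 else 0) +
      (if c y = c z then 1 else 0)) := by
  rw [Finset.card_filter, Finset.sum_product]
  have hx : x ∉ ({y, z} : Finset V) := by simp [hxy, hxz]
  have hy : y ∉ ({z} : Finset V) := by simp [hyz]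
  simp only [Finset.sum_insert hx, Finset.sum_insert hy, Finset.sum_singleton, colG]
  simp only [ne_eq, hxy, hxz, hyz, hxy.symm, hxz.symm, hyz.symm, not_true_eq_false,
    not_false_eq_true, false_and, true_and, if_false]
  simp only [eq_comm (a := c y) (b := c x), eq_comm (a := c z) (b := c x),
    eq_comm (a := c z) (b := c y)]
  ring

lemma dens_two {V : Type} [Fintype V] (c : V → Fin 3) : tripleDensity (colG c) 2 = 0 := by
  classical
  unfold tripleDensity
  rw [Finset.filter_eq_empty_iff.2]
  · simp
  · intro s hs
    obtain ⟨x, y, z, hxy, hxz, hyz, rfl⟩ := Finset.card_eq_three.1 (Finset.mem_powersetCard.1 hs).2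
    have := colG_edges c hxy hxz hyz
    intro h
    have h2 := this.symm.trans (by convert h)
    by_cases h1 : c x = c y <;> by_cases h3 : c x = c z <;> by_cases h4 : c y = c z <;>
      simp_all

lemma dens_three {V : Type} [Fintype V] (c : V → Fin 3) : tripleDensity (colG c) 3 =
    ((((univ.filter fun v => c v = 0).card.choose 3 : ℕ) : ℝ) +
      ((univ.filter fun v => c v = 1).card.choose 3 : ℕ) +
      ((univ.filter fun v => c v = 2).card.choose 3 : ℕ)) / ((Fintype.card V).choose 3) := by
  classical
  unfold tripleDensity
  congr 1
  rw [← Finset.card_powersetCard, ← Finset.card_powersetCard, ← Finset.card_powersetCard,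
    ← Nat.cast_add, ← Nat.cast_add, ← Finset.card_union_of_disjoint,
    ← Finset.card_union_of_disjoint]
  · congr 2
    ext s
    simp only [Finset.mem_filter, Finset.mem_union, Finset.mem_powersetCard]
    by_cases hs : s.card = 3
    · obtain ⟨x, y, z, hxy, hxz, hyz, rfl⟩ := Finset.card_eq_three.1 hs
      have := colG_edges c hxy hxz hyz
      simp only [hs, and_true, Finset.subset_univ, true_and]
      have e : ∀ i : Fin 3, (({x, y, z} : Finset V) ⊆ univ.filter fun v => c v = i) ↔
          c x = i ∧ c y = i ∧ c z = i := by
        intro i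
        simp [Finset.insert_subset_iff]
      rw [e, e, e]
      trans (2 * ((if c x = c y then 1 else 0) + (if c x = c z then 1 else 0) +
        (if c y = c z then 1 else 0)) = 2 * 3)
      · rw [← this]
      · generalize c x = a
        generalize c y = b
        generalize c z = d
        revert a b d
        decide
    · simp [hs]
  · rw [Finset.disjoint_left]
    intro s hs ht
    simp only [Finset.mem_union, Finset.mem_powersetCard] at hs ht
    obtain ⟨x, hx⟩ : s.Nonempty := Finset.card_pos.1 (by omega)
    have h2 := ht.1 hx
    rcases hs with hs | hs <;> have h1 := hs.1 hx <;> simp_all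
  · rw [Finset.disjoint_left]
    intro s hs ht
    simp only [Finset.mem_powersetCard] at hs ht
    obtain ⟨x, hx⟩ : s.Nonempty := Finset.card_pos.1 (by omega)
    have h2 := ht.1 hx
    have h1 := hs.1 hx
    simp_all

lemma dens_zero {V : Type} [Fintype V] (c : V → Fin 3) : tripleDensity (colG c) 0 =
    (((univ.filter fun v => c v = 0).card : ℝ) * ((univ.filter fun v => c v = 1).card : ℝ) *
      ((univ.filter fun v => c v = 2).card : ℝ)) / ((Fintype.card V).choose 3) := by
  classical
  unfold tripleDensity
  congr 1
  rw [← Nat.cast_mul, ← Nat.cast_mul, ← Finset.card_product, ← Finset.card_product]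
  congr 1
  symm
  have key : ∀ x y z : V, c x = 0 → c y = 1 → c z = 2 → x ≠ y ∧ x ≠ z ∧ y ≠ z := by
    intro x y z hx hy hz
    refine ⟨?_, ?_, ?_⟩ <;> rintro rfl <;> simp_all
  refine Finset.card_bij (fun p _ => ({p.1.1, p.1.2, p.2} : Finset V)) ?_ ?_ ?_
  · rintro ⟨⟨x, y⟩, z⟩ h
    simp only [Finset.mem_product, Finset.mem_filter, Finset.mem_univ, true_and] at h
    obtain ⟨⟨hx, hy⟩, hz⟩ := h
    obtain ⟨hxy, hxz, hyz⟩ := key x y z hx hy hz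
    have := colG_edges c hxy hxz hyz
    simp only [Finset.mem_filter, Finset.mem_powersetCard, Finset.subset_univ, true_and]
    refine ⟨Finset.card_eq_three.2 ⟨x, y, z, hxy, hxz, hyz, rfl⟩, ?_⟩
    rw [hx, hy, hz] at this
    convert this using 1
    simp
  · rintro ⟨⟨x, y⟩, z⟩ h ⟨⟨x', y'⟩, z'⟩ h' e
    simp only [Finset.mem_product, Finset.mem_filter, Finset.mem_univ, true_and] at h h'
    obtain ⟨⟨hx, hy⟩, hz⟩ := h
    obtain ⟨⟨hx', hy'⟩, hz'⟩ := h'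
    simp only at e
    have mx : x ∈ ({x', y', z'} : Finset V) := e ▸ (by simp)
    have my : y ∈ ({x', y', z'} : Finset V) := e ▸ (by simp)
    have mz : z ∈ ({x', y', z'} : Finset V) := e ▸ (by simp)
    simp only [Finset.mem_insert, Finset.mem_singleton] at mx my mz
    have h1 : x = x' := by
      rcases mx with h | h | h
      · exact h
      · subst h; simp_all
      · subst h; simp_all
    have h2 : y = y' := by
      rcases my with h | h | h
      · subst h; simp_all
      · exact h
      · subst h; simp_all
    have h3 : z = z' := by
      rcases mz with h | h | h
      · subst h; simp_all
      · subst h; simp_all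
      · exact h
    rw [h1, h2, h3]
  · intro s hs
    simp only [Finset.mem_filter, Finset.mem_powersetCard, Finset.subset_univ, true_and] at hs
    obtain ⟨hs, he⟩ := hs
    obtain ⟨x, y, z, hxy, hxz, hyz, rfl⟩ := Finset.card_eq_three.1 hs
    have := colG_edges c hxy hxz hyz
    have h2 := this.symm.trans (by convert he)
    have h3 : ∀ a b d : Fin 3, 2 * ((if a = b then 1 else 0) + (if a = d then 1 else 0) +
        (if b = d then 1 else 0)) = 2 * 0 →
        ∀ i, a = i ∨ b = i ∨ d = i := by decide
    have h4 := h3 _ _ _ h2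
    have h5 : ∀ i, ∃ w ∈ ({x, y, z} : Finset V), c w = i := by
      intro i
      rcases h4 i with h | h | h
      · exact ⟨x, by simp, h⟩
      · exact ⟨y, by simp, h⟩
      · exact ⟨z, by simp, h⟩
    obtain ⟨x', mx, hx⟩ := h5 0
    obtain ⟨y', my, hy⟩ := h5 1
    obtain ⟨z', mz, hz⟩ := h5 2
    obtain ⟨hxy', hxz', hyz'⟩ := key x' y' z' hx hy hz
    refine ⟨((x', y'), z'), by simp [hx, hy, hz], ?_⟩
    apply Finset.eq_of_subset_of_card_le
    · intro w hw
      simp only [Finset.mem_insert, Finset.mem_singleton] at hw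
      rcases hw with rfl | rfl | rfl <;> assumption
    · rw [hs]
      exact (Finset.card_eq_three.2 ⟨x', y', z', hxy', hxz', hyz', rfl⟩).ge

/-- The colouring with classes of sizes `k`, `k`, `n - 2k`. -/
def colk (n k : ℕ) (i : Fin n) : Fin 3 :=
  if i.val < k then 0 else if i.val < 2 * k then 1 else 2

lemma card_lt (n k : ℕ) (h : k ≤ n) : (univ.filter fun i : Fin n => i.val < k).card = k := by
  rw [Fin.card_filter_val_lt]; omega

lemma col0 (n k : ℕ) (h : 2 * k ≤ n) : (univ.filter fun i => colk n k i = 0).card = k := by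
  rw [← card_lt n k (by omega)]
  congr 1
  ext i
  simp only [colk, Finset.mem_filter, Finset.mem_univ, true_and, card_lt n k (by omega)]
  split_ifs <;> simp_all

lemma col1 (n k : ℕ) (h : 2 * k ≤ n) : (univ.filter fun i => colk n k i = 1).card = k := by
  have e : (univ.filter fun i => colk n k i = 1) =
      (univ.filter fun i : Fin n => i.val < 2 * k) \ (univ.filter fun i : Fin n => i.val < k) := by
    ext i
    simp only [Finset.mem_filter, Finset.mem_univ, true_and, Finset.mem_sdiff]
    unfold colk
    split_ifs <;> simp_all
  rw [e, Finset.card_sdiff_of_subset, card_lt _ _ h, card_lt _ _ (by omega)]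
  · omega
  · intro i
    simp only [Finset.mem_filter, Finset.mem_univ, true_and]
    omega

lemma col2 (n k : ℕ) (h : 2 * k ≤ n) :
    (univ.filter fun i => colk n k i = 2).card = n - 2 * k := by
  have e : (univ.filter fun i => colk n k i = 2) =
      univ \ (univ.filter fun i : Fin n => i.val < 2 * k) := by
    ext i
    simp only [Finset.mem_filter, Finset.mem_univ, true_and, Finset.mem_sdiff]
    unfold colk
    split_ifs
    · simp; omega
    · simp_all
    · simp_all
  rw [e, Finset.card_sdiff_of_subset (Finset.subset_univ _), card_lt _ _ h]
  simp

lemma choose3 (n : ℕ) : ((n.choose 3 : ℕ) : ℝ) = n * (n - 1) * (n - 2) / 6 := by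
  induction n with
  | zero => simp
  | succ n ih =>
    rw [Nat.choose_succ_succ, Nat.cast_add, ih, Nat.cast_choose_two]
    push_cast
    ring

theorem rho_is_tight (θ ρ : ℝ)
    (hθroot : θ ^ 3 + θ ^ 2 - θ + 1 / 6 = 0)
    (hθmax : ∀ x : ℝ, x ^ 3 + x ^ 2 - x + 1 / 6 = 0 → x ≤ θ)
    (hρ : ρ = 6 * θ ^ 2 * (1 - 2 * θ)) :
    ∀ ε : ℝ, 0 < ε → ∀ M : ℕ, ∃ n : ℕ, M ≤ n ∧ ∃ G : SimpleGraph (Fin n),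
      tripleDensity G 2 = 0 ∧
      |tripleDensity G 0 - ρ| ≤ ε ∧ |tripleDensity G 3 - ρ| ≤ ε := by
  have h0 : 0 ≤ θ := by
    have hc : ContinuousOn (fun x : ℝ => x ^ 3 + x ^ 2 - x + 1 / 6) (Set.Icc (2/5) (1/2)) := by
      fun_prop
    obtain ⟨x, hx, hfx⟩ := intermediate_value_Icc (by norm_num) hc
      (show (0 : ℝ) ∈ _ by constructor <;> norm_num)
    have := hθmax x hfx
    linarith [hx.1]
  have h1 : θ ≤ 1 / 2 := by
    by_contra! h
    nlinarith [mul_pos (sub_pos.2 h) (sub_pos.2 h), pow_pos (sub_pos.2 h) 3]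
  intro ε hε M
  let k : ℕ → ℕ := fun n => ⌊θ * n⌋₊
  have hk : ∀ n, 2 * k n ≤ n := by
    intro n
    have h2 : (k n : ℝ) ≤ θ * n := Nat.floor_le (by positivity)
    have h3 : θ * n ≤ 1 / 2 * n := by gcongr
    have : ((2 * k n : ℕ) : ℝ) ≤ n := by push_cast; linarith
    exact_mod_cast this
  have hx : Tendsto (fun n : ℕ => (k n : ℝ) / n) atTop (𝓝 θ) :=
    (tendsto_nat_floor_mul_div_atTop h0).comp tendsto_natCast_atTop_atTop
  have hi : Tendsto (fun n : ℕ => (1 : ℝ) / n) atTop (𝓝 0) := tendsto_one_div_atTop_nhds_zero_nat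
  have hd : Tendsto (fun n : ℕ => (1 - (1 : ℝ) / n) * (1 - 2 * ((1 : ℝ) / n))) atTop (𝓝 1) := by
    have := (hi.const_sub 1).mul ((hi.const_mul 2).const_sub 1)
    simpa using this
  have hch : ∀ (f : ℕ → ℝ) (a : ℝ), Tendsto f atTop (𝓝 a) →
      Tendsto (fun n => f n * (f n - (1 : ℝ) / n) * (f n - 2 * ((1 : ℝ) / n))) atTop
        (𝓝 (a ^ 3)) := by
    intro f a hf
    have := (hf.mul (hf.sub hi)).mul (hf.sub (hi.const_mul 2))
    convert this using 2
    ring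
  have t0 : Tendsto (fun n => tripleDensity (colG (colk n (k n))) 0) atTop (𝓝 ρ) := by
    have := ((((hx.pow 2).const_mul 6).mul ((hx.const_mul 2).const_sub 1))).div hd one_ne_zero
    rw [div_one, ← hρ] at this
    refine this.congr' ?_
    filter_upwards [eventually_ge_atTop 3] with n hn
    have hn' : (3 : ℝ) ≤ n := by exact_mod_cast hn
    have a1 : (n : ℝ) ≠ 0 := by linarith
    have a2 : (n : ℝ) - 1 ≠ 0 := by linarith
    have a3 : (n : ℝ) - 2 ≠ 0 := by linarith
    rw [dens_zero, col0 _ _ (hk n), col1 _ _ (hk n), col2 _ _ (hk n), Nat.cast_sub (hk n),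
      Fintype.card_fin, choose3]
    push_cast
    simp only [Pi.div_apply]
    field_simp
  have t3 : Tendsto (fun n => tripleDensity (colG (colk n (k n))) 3) atTop (𝓝 ρ) := by
    have := ((((hch _ _ hx).const_mul 2).add (hch _ _ ((hx.const_mul 2).const_sub 1)))).div hd
      one_ne_zero
    have e : (2 * θ ^ 3 + (1 - 2 * θ) ^ 3) / 1 = ρ := by
      rw [hρ]; linear_combination 6 * hθroot
    rw [e] at this
    refine this.congr' ?_
    filter_upwards [eventually_ge_atTop 3] with n hn
    have hn' : (3 : ℝ) ≤ n := by exact_mod_cast hn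
    have a1 : (n : ℝ) ≠ 0 := by linarith
    have a2 : (n : ℝ) - 1 ≠ 0 := by linarith
    have a3 : (n : ℝ) - 2 ≠ 0 := by linarith
    rw [dens_three, col0 _ _ (hk n), col1 _ _ (hk n), col2 _ _ (hk n),
      Fintype.card_fin, choose3, choose3, choose3, Nat.cast_sub (hk n)]
    push_cast
    simp only [Pi.div_apply]
    field_simp
    ring
  have e0 := (Metric.tendsto_nhds.1 t0) ε hε
  have e3 := (Metric.tendsto_nhds.1 t3) ε hε
  obtain ⟨n, ⟨g0, g3⟩, hM⟩ := ((e0.and e3).and (eventually_ge_atTop M)).exists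
  rw [Real.dist_eq] at g0 g3
  exact ⟨n, hM, colG (colk n (k n)), dens_two _, g0.le, g3.le⟩
end

section
/- (Goodman) For every finite simple graph G on n vertices, the number of triangles in G plus the number of triangles in the complement of G is at least n(n−1)(n−5)/24. In particular, for every ε > 0 there is N such that every graph on n ≥ N vertices satisfies p₀(G) + p₃(G) ≥ 1/4 − ε. -/
open Finset

-- number of 3-element vertex subsets inducing a triangle
open Classical in
noncomputable def triangleCount {V : Type} [Fintype V] (G : SimpleGraph V) : ℕ :=
  (((univ : Finset V).powersetCard 3).filter (fun s => G.IsClique (s : Set V))).card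

open Classical in
/-- `triangleCount` as a count of finsets (the coercion to sets is injective). -/
lemma triangleCount_eq {V : Type} [Fintype V] (G : SimpleGraph V)
    [DecidablePred (fun s : Finset V => G.IsClique (s : Set V))] :
    triangleCount G = (((univ : Finset V).powersetCard 3).filter
      (fun s : Finset V => G.IsClique (s : Set V))).card := by
  unfold triangleCount
  symm
  apply Finset.card_bij (fun (s : Finset V) _ => (s : Set V))
  · intro s hs
    rw [Finset.mem_filter] at hs ⊢
    refine ⟨?_, hs.2⟩
    simp only [Finset.bind_def, Finset.mem_sup, Finset.pure_def, Finset.mem_singleton]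
    exact ⟨s, hs.1, rfl⟩
  · intro s _ t _ h
    exact Finset.coe_injective h
  · intro t ht
    rw [Finset.mem_filter] at ht
    obtain ⟨h1, h2⟩ := ht
    simp only [Finset.bind_def, Finset.mem_sup, Finset.pure_def, Finset.mem_singleton] at h1
    obtain ⟨s, hs, rfl⟩ := h1
    exact ⟨s, Finset.mem_filter.mpr ⟨hs, h2⟩, rfl⟩

open Classical in
/-- A non-monochromatic 3-set contains at least two bichromatic cherries. -/
lemma goodman_fiber {V : Type} [Fintype V] (G : SimpleGraph V) (s : Finset V)
    (hs : s.card = 3) (h1 : ¬ G.IsClique (s : Set V)) (h2 : ¬ Gᶜ.IsClique (s : Set V)) :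
    2 ≤ (((univ : Finset (V × V × V)).filter
      (fun p => G.Adj p.1 p.2.1 ∧ Gᶜ.Adj p.1 p.2.2)).filter
      (fun p => ({p.1, p.2.1, p.2.2} : Finset V) = s)).card := by
  obtain ⟨a, b, c, hab, hac, hbc, rfl⟩ := Finset.card_eq_three.mp hs
  have key : ∀ p q : V × V × V, p ≠ q →
      (G.Adj p.1 p.2.1 ∧ Gᶜ.Adj p.1 p.2.2) → (G.Adj q.1 q.2.1 ∧ Gᶜ.Adj q.1 q.2.2) →
      ({p.1, p.2.1, p.2.2} : Finset V) = {a, b, c} →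
      ({q.1, q.2.1, q.2.2} : Finset V) = {a, b, c} →
      2 ≤ (((univ : Finset (V × V × V)).filter
      (fun p => G.Adj p.1 p.2.1 ∧ Gᶜ.Adj p.1 p.2.2)).filter
      (fun p => ({p.1, p.2.1, p.2.2} : Finset V) = {a, b, c})).card := by
    intro p q hpq hp hq hp' hq'
    rw [← Finset.card_pair hpq]
    apply Finset.card_le_card
    intro r hr
    simp only [Finset.mem_insert, Finset.mem_singleton] at hr
    rcases hr with rfl | rfl
    · simp only [Finset.mem_filter, Finset.mem_univ, true_and]; exact ⟨hp, hp'⟩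
    · simp only [Finset.mem_filter, Finset.mem_univ, true_and]; exact ⟨hq, hq'⟩
  have e1 : ({a, c, b} : Finset V) = {a, b, c} := by ext; simp; tauto
  have e2 : ({b, a, c} : Finset V) = {a, b, c} := by ext; simp; tauto
  have e3 : ({b, c, a} : Finset V) = {a, b, c} := by ext; simp; tauto
  have e4 : ({c, a, b} : Finset V) = {a, b, c} := by ext; simp; tauto
  have e5 : ({c, b, a} : Finset V) = {a, b, c} := by ext; simp; tauto
  have sab := G.adj_comm a b
  have sac := G.adj_comm a c
  have sbc := G.adj_comm b c
  simp only [SimpleGraph.compl_adj] at key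
  by_cases x : G.Adj a b <;> by_cases y : G.Adj a c <;> by_cases z : G.Adj b c
  · exfalso; apply h1
    simp [SimpleGraph.isClique_iff, Set.Pairwise]; grind
  · exact key (b, a, c) (c, a, b) (by grind) (by grind) (by grind) e2 e4
  · exact key (a, b, c) (c, b, a) (by grind) (by grind) (by grind) rfl e5
  · exact key (a, b, c) (b, a, c) (by grind) (by grind) (by grind) rfl e2
  · exact key (a, c, b) (b, c, a) (by grind) (by grind) (by grind) e1 e3
  · exact key (a, c, b) (c, a, b) (by grind) (by grind) (by grind) e1 e4
  · exact key (b, c, a) (c, b, a) (by grind) (by grind) (by grind) e3 e5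
  · exfalso; apply h2
    simp [SimpleGraph.isClique_iff, Set.Pairwise]; grind

open Classical in
/-- The number of bichromatic cherries is at most `n(n-1)²/4`. -/
lemma goodman_cherries {V : Type} [Fintype V] (G : SimpleGraph V) :
    (((univ : Finset (V × V × V)).filter
      (fun p => G.Adj p.1 p.2.1 ∧ Gᶜ.Adj p.1 p.2.2)).card : ℝ) ≤
      (Fintype.card V : ℝ) * ((Fintype.card V - 1) ^ 2 / 4) := by
  have h : ((univ : Finset (V × V × V)).filter
      (fun p => G.Adj p.1 p.2.1 ∧ Gᶜ.Adj p.1 p.2.2)).card =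
      ∑ v : V, G.degree v * Gᶜ.degree v := by
    rw [Finset.card_eq_sum_card_fiberwise (f := fun p => p.1) (t := univ) (by simp)]
    apply Finset.sum_congr rfl
    intro v _
    rw [← SimpleGraph.card_neighborFinset_eq_degree, ← SimpleGraph.card_neighborFinset_eq_degree,
      ← Finset.card_product]
    symm
    apply Finset.card_bij (fun q _ => (v, q))
    · intro q hq
      simp only [Finset.mem_product, SimpleGraph.mem_neighborFinset] at hq
      simp only [Finset.mem_filter, Finset.mem_univ, true_and, and_true]
      exact hq
    · intro q _ r _ h
      exact (Prod.mk.inj h).2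
    · rintro ⟨w, q⟩ hq
      simp only [Finset.mem_filter, Finset.mem_univ, true_and] at hq
      obtain ⟨hq, rfl⟩ := hq
      refine ⟨q, ?_, rfl⟩
      simp only [Finset.mem_product, SimpleGraph.mem_neighborFinset]
      exact hq
  rw [h]
  push_cast
  calc ∑ v : V, (G.degree v : ℝ) * (Gᶜ.degree v : ℝ)
      ≤ ∑ _v : V, ((Fintype.card V : ℝ) - 1) ^ 2 / 4 := by
        apply Finset.sum_le_sum
        intro v _
        have h1 : Gᶜ.degree v = Fintype.card V - 1 - G.degree v := by
          convert G.degree_compl v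
        have h2 := G.degree_lt_card_verts v
        have h3 : (G.degree v : ℝ) + (Gᶜ.degree v : ℝ) = (Fintype.card V : ℝ) - 1 := by
          have : G.degree v + Gᶜ.degree v + 1 = Fintype.card V := by omega
          rw [← this]; push_cast; ring
        rw [← h3]
        nlinarith [sq_nonneg ((G.degree v : ℝ) - (Gᶜ.degree v : ℝ))]
    _ = _ := by simp

lemma choose_three_real (n : ℕ) :
    ((n.choose 3 : ℕ) : ℝ) = (n : ℝ) * (n - 1) * (n - 2) / 6 := by
  rcases n with _ | _ | n
  · simp
  · simp [Nat.choose]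
  have h := Nat.descFactorial_eq_factorial_mul_choose (n + 2) 3
  have h2 : (((n + 2).descFactorial 3 : ℕ) : ℝ) =
      ((Nat.factorial 3 * (n + 2).choose 3 : ℕ) : ℝ) := by rw [h]
  simp [Nat.descFactorial, Nat.factorial] at h2
  push_cast
  linarith

open Classical in
lemma goodman_count {V : Type} [Fintype V] (G : SimpleGraph V) :
    ((Fintype.card V : ℝ) * (Fintype.card V - 1) * (Fintype.card V - 5)) / 24 ≤
        (triangleCount G : ℝ) + (triangleCount Gᶜ : ℝ) := by
  set U := (univ : Finset V).powersetCard 3 with hU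
  set P := (univ : Finset (V × V × V)).filter
      (fun p => G.Adj p.1 p.2.1 ∧ Gᶜ.Adj p.1 p.2.2) with hP
  set M := U.filter (fun s : Finset V => ¬ G.IsClique (s : Set V) ∧ ¬ Gᶜ.IsClique (s : Set V)) with hM
  have hMP : M.card * 2 ≤ P.card := by
    calc M.card * 2 = ∑ _s ∈ M, 2 := by simp
      _ ≤ ∑ s ∈ M, (P.filter (fun p => ({p.1, p.2.1, p.2.2} : Finset V) = s)).card := by
          apply Finset.sum_le_sum
          intro s hs
          simp only [hM, hU, Finset.mem_filter, Finset.mem_powersetCard] at hs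
          exact goodman_fiber G s hs.1.2 hs.2.1 hs.2.2
      _ = (P.filter (fun p => ({p.1, p.2.1, p.2.2} : Finset V) ∈ M)).card := by
          rw [Finset.card_eq_sum_card_fiberwise (t := M)
            (s := P.filter (fun p => ({p.1, p.2.1, p.2.2} : Finset V) ∈ M))
            (f := fun p : V × V × V => ({p.1, p.2.1, p.2.2} : Finset V))
            (fun p hp => (Finset.mem_filter.mp hp).2)]
          apply Finset.sum_congr rfl
          intro s hs
          congr 1
          ext p
          simp only [Finset.mem_filter]
          constructor
          · rintro ⟨h, rfl⟩; exact ⟨⟨h, hs⟩, rfl⟩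
          · rintro ⟨⟨h, _⟩, h'⟩; exact ⟨h, h'⟩
      _ ≤ P.card := Finset.card_filter_le _ _
  have hcover : U.card ≤ triangleCount G + triangleCount Gᶜ + M.card := by
    have : U ⊆ (U.filter (fun s : Finset V => G.IsClique (s : Set V)) ∪
        U.filter (fun s : Finset V => Gᶜ.IsClique (s : Set V))) ∪ M := by
      intro s hs
      simp only [hM, Finset.mem_union, Finset.mem_filter]
      tauto
    refine (Finset.card_le_card this).trans ((Finset.card_union_le _ _).trans ?_)
    rw [triangleCount_eq G, triangleCount_eq Gᶜ]
    exact Nat.add_le_add_right (Finset.card_union_le _ _) _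
  have hUc : (U.card : ℝ) =
      (Fintype.card V : ℝ) * (Fintype.card V - 1) * (Fintype.card V - 2) / 6 := by
    rw [← choose_three_real, hU, Finset.card_powersetCard, Finset.card_univ]
  have hch := goodman_cherries G
  rw [← hP] at hch
  have a1 : (M.card : ℝ) * 2 ≤ P.card := by exact_mod_cast hMP
  have a2 : (U.card : ℝ) ≤ triangleCount G + triangleCount Gᶜ + M.card := by
    exact_mod_cast hcover
  rw [hUc] at a2
  nlinarith

open Classical in
lemma triangle_le_three {V : Type} [Fintype V] (G : SimpleGraph V) :
    (triangleCount G : ℝ) / ((Fintype.card V).choose 3 : ℕ) ≤ tripleDensity G 3 := by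
  rw [triangleCount_eq (G := _)]
  unfold tripleDensity
  gcongr ?_ / _
  rw [Nat.cast_le]
  apply Finset.card_le_card
  intro s hs
  obtain ⟨hs, h⟩ := Finset.mem_filter.mp hs
  refine Finset.mem_filter.mpr ⟨hs, ?_⟩
  simp only [Finset.mem_powersetCard] at hs
  have : ((s ×ˢ s).filter fun q => G.Adj q.1 q.2) = s.offDiag := by
    ext ⟨x, y⟩
    simp only [Finset.mem_filter, Finset.mem_product, Finset.mem_offDiag]
    constructor
    · rintro ⟨⟨hx, hy⟩, hxy⟩
      exact ⟨hx, hy, hxy.ne⟩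
    · rintro ⟨hx, hy, hxy⟩
      exact ⟨⟨hx, hy⟩, h hx hy hxy⟩
  rw [this, Finset.offDiag_card, hs.2]

open Classical in
lemma triangle_le_zero {V : Type} [Fintype V] (G : SimpleGraph V) :
    (triangleCount Gᶜ : ℝ) / ((Fintype.card V).choose 3 : ℕ) ≤ tripleDensity G 0 := by
  rw [triangleCount_eq (G := _)]
  unfold tripleDensity
  gcongr ?_ / _
  rw [Nat.cast_le]
  apply Finset.card_le_card
  intro s hs
  obtain ⟨hs, h⟩ := Finset.mem_filter.mp hs
  refine Finset.mem_filter.mpr ⟨hs, ?_⟩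
  rw [mul_zero, Finset.card_eq_zero, Finset.filter_eq_empty_iff]
  rintro ⟨x, y⟩ hxy hadj
  rw [Finset.mem_product] at hxy
  have := h hxy.1 hxy.2 hadj.ne
  rw [SimpleGraph.compl_adj] at this
  exact this.2 hadj

/-- Goodman's theorem: the number of triangles of `G` plus the number of triangles of its
complement is at least `n(n-1)(n-5)/24`; consequently `p₀ + p₃ ≥ 1/4 - ε` for all large
graphs. -/
theorem goodman :
    (∀ (V : Type) [Fintype V] (G : SimpleGraph V),
      ((Fintype.card V : ℝ) * (Fintype.card V - 1) * (Fintype.card V - 5)) / 24 ≤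
        (triangleCount G : ℝ) + (triangleCount Gᶜ : ℝ)) ∧
    ∀ ε : ℝ, 0 < ε → ∃ N : ℕ, ∀ (V : Type) [Fintype V] (G : SimpleGraph V),
      N ≤ Fintype.card V →
      1 / 4 - ε ≤ tripleDensity G 0 + tripleDensity G 3 := by
  refine ⟨fun V _ G => goodman_count G, ?_⟩
  intro ε hε
  obtain ⟨K, hK⟩ := exists_nat_gt (1 / ε)
  refine ⟨K + 3, fun V _ G hn => ?_⟩
  have h0 := triangle_le_zero G
  have h3 := triangle_le_three G
  have hc := goodman_count G
  have hn' : (K : ℝ) + 3 ≤ Fintype.card V := by exact_mod_cast hn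
  rw [choose_three_real] at h0 h3
  generalize (Fintype.card V : ℝ) = n at *
  have hK0 : (0 : ℝ) ≤ K := Nat.cast_nonneg K
  have hn0 : 0 < n := by linarith
  have hn1 : 0 < n - 1 := by linarith
  have hn2 : 0 < n - 2 := by linarith
  refine le_trans ?_ (add_le_add h0 h3)
  rw [← add_div]
  have hD : 0 < n * (n - 1) * (n - 2) / 6 := by positivity
  rw [le_div_iff₀ hD]
  refine le_trans ?_ (hc.trans (le_of_eq (add_comm _ _)))
  have hKe : 1 < ε * (n - 2) := by
    rw [div_lt_iff₀ hε] at hK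
    nlinarith
  nlinarith [mul_pos (mul_pos hn0 hn1) (sub_pos.mpr hKe), mul_pos hn0 hn1]
end

section
/- For every tournament T on n ≥ 5 vertices, the number of 4-element vertex subsets inducing a subtournament isomorphic to T₄ plus the number inducing L₄ is at least n(n−1)(n−3)(n−5)/48, and likewise the number inducing T₄ plus the number inducing W₄ is at least n(n−1)(n−3)(n−5)/48. Consequently, for every ε > 0 there is N such that every tournament on n ≥ N vertices satisfies t₄ + l₄ ≥ 1/2 − ε and t₄ + w₄ ≥ 1/2 − ε. -/
open Finset

/-- A tournament: an irreflexive relation such that for distinct vertices exactly one of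
`r x y`, `r y x` holds. -/
def IsTournament {V : Type} (r : V → V → Prop) : Prop :=
  (∀ x, ¬ r x x) ∧ ∀ x y : V, x ≠ y → (r x y ↔ ¬ r y x)

/-- The transitive tournament on 4 vertices. -/
def T4rel : Fin 4 → Fin 4 → Prop := fun i j => i < j

/-- The unique strongly connected tournament on 4 vertices. -/
def C4rel : Fin 4 → Fin 4 → Prop := fun i j =>
  (i = 0 ∧ j = 1) ∨ (i = 1 ∧ j = 2) ∨ (i = 2 ∧ j = 3) ∨ (i = 3 ∧ j = 0) ∨
  (i = 0 ∧ j = 2) ∨ (i = 1 ∧ j = 3)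

/-- The 4-vertex tournament in which a cyclic triangle beats a fourth vertex. -/
def W4rel : Fin 4 → Fin 4 → Prop := fun i j =>
  (i = 0 ∧ j = 1) ∨ (i = 1 ∧ j = 2) ∨ (i = 2 ∧ j = 0) ∨
  (i = 0 ∧ j = 3) ∨ (i = 1 ∧ j = 3) ∨ (i = 2 ∧ j = 3)

/-- The 4-vertex tournament in which one vertex beats a cyclic triangle. -/
def L4rel : Fin 4 → Fin 4 → Prop := fun i j =>
  (i = 0 ∧ j = 1) ∨ (i = 1 ∧ j = 2) ∨ (i = 2 ∧ j = 0) ∨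
  (i = 3 ∧ j = 0) ∨ (i = 3 ∧ j = 1) ∨ (i = 3 ∧ j = 2)

/-- The cyclic triangle (directed 3-cycle). -/
def C3rel : Fin 3 → Fin 3 → Prop := fun i j =>
  (i = 0 ∧ j = 1) ∨ (i = 1 ∧ j = 2) ∨ (i = 2 ∧ j = 0)

/-- `s` induces a subtournament isomorphic to the pattern `m`. -/
def InducesPattern {V : Type} {k : ℕ} (r : V → V → Prop) (m : Fin k → Fin k → Prop)
    (s : Finset V) : Prop :=
  ∃ f : Fin k → V, Function.Injective f ∧ Set.range f = (s : Set V) ∧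
    ∀ i j : Fin k, m i j ↔ r (f i) (f j)

-- the number of `k`-element vertex subsets inducing a copy of the pattern `m`
open Classical in
noncomputable def patternCount {V : Type} [Fintype V] {k : ℕ} (r : V → V → Prop)
    (m : Fin k → Fin k → Prop) : ℕ :=
  (((univ : Finset V).powersetCard k).filter (fun s => InducesPattern r m s)).card

-- the probability that a uniformly random `k`-element vertex subset induces a copy of `m`
noncomputable def patternDensity {V : Type} [Fintype V] {k : ℕ} (r : V → V → Prop)
    (m : Fin k → Fin k → Prop) : ℝ :=
  (patternCount r m : ℝ) / ((Fintype.card V).choose k)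

lemma tour_asymm {V : Type} {r : V → V → Prop} (h : IsTournament r) {x y : V} (hxy : r x y) :
    ¬ r y x := by
  have hne : x ≠ y := by
    rintro rfl
    exact h.1 _ hxy
  exact (h.2 x y hne).1 hxy

lemma tour_total {V : Type} {r : V → V → Prop} (h : IsTournament r) {x y : V} (hne : x ≠ y) :
    r x y ∨ r y x := by
  by_cases hyx : r y x
  · exact Or.inr hyx
  · exact Or.inl ((h.2 x y hne).2 hyx)

lemma tour_flip {V : Type} {r : V → V → Prop} (h : IsTournament r) :
    IsTournament (fun x y => r y x) :=
  ⟨h.1, fun x y hne => h.2 y x hne.symm⟩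

lemma tour_ne {V : Type} {r : V → V → Prop} (h : IsTournament r) {x y : V} (hxy : r x y) :
    x ≠ y := by
  rintro rfl
  exact h.1 _ hxy

/-- `x → y → z` with `v` beating all. -/
lemma pattern_of_path {V : Type} [DecidableEq V] {r : V → V → Prop} (h : IsTournament r)
    {v x y z : V}
    (hx : r v x) (hy : r v y) (hz : r v z) (hxy : r x y) (hyz : r y z) (hxz : x ≠ z) :
    InducesPattern r T4rel {v, x, y, z} ∨ InducesPattern r L4rel {v, x, y, z} := by
  have n1 := tour_ne h hx
  have n2 := tour_ne h hy
  have n3 := tour_ne h hz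
  have n4 := tour_ne h hxy
  have n5 := tour_ne h hyz
  have a1 := tour_asymm h hx
  have a2 := tour_asymm h hy
  have a3 := tour_asymm h hz
  have a4 := tour_asymm h hxy
  have a5 := tour_asymm h hyz
  have i1 := h.1 v
  have i2 := h.1 x
  have i3 := h.1 y
  have i4 := h.1 z
  rcases tour_total h hxz with hc | hc
  · left
    have a6 := tour_asymm h hc
    refine ⟨![v, x, y, z], ?_, ?_, ?_⟩
    · intro i j hij
      fin_cases i <;> fin_cases j <;> simp_all
    · ext w
      simp [eq_comm]
      tauto
    · intro i j
      fin_cases i <;> fin_cases j <;> simp [T4rel, *]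
  · right
    have a6 := tour_asymm h hc
    refine ⟨![x, y, z, v], ?_, ?_, ?_⟩
    · intro i j hij
      fin_cases i <;> fin_cases j <;> simp_all
    · ext w
      simp [eq_comm]
      tauto
    · intro i j
      fin_cases i <;> fin_cases j <;> simp [L4rel, *]

lemma pattern_of_source {V : Type} [DecidableEq V] {r : V → V → Prop} (h : IsTournament r)
    {v : V} {s : Finset V} (hs : s.card = 3) (hv : ∀ w ∈ s, r v w) :
    InducesPattern r T4rel (insert v s) ∨ InducesPattern r L4rel (insert v s) := by
  obtain ⟨a, b, c, hab, hac, hbc, rfl⟩ := Finset.card_eq_three.1 hs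
  have ha : r v a := hv a (by simp)
  have hb : r v b := hv b (by simp)
  have hc : r v c := hv c (by simp)
  have p1 : ({a, b, c} : Finset V) = {a, c, b} := by ext; simp; tauto
  have p2 : ({a, b, c} : Finset V) = {b, a, c} := by ext; simp; tauto
  have p3 : ({a, b, c} : Finset V) = {b, c, a} := by ext; simp; tauto
  have p4 : ({a, b, c} : Finset V) = {c, a, b} := by ext; simp; tauto
  have p5 : ({a, b, c} : Finset V) = {c, b, a} := by ext; simp; tauto
  rcases tour_total h hab with h1 | h1
  · rcases tour_total h hbc with h2 | h2
    · exact pattern_of_path h ha hb hc h1 h2 hac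
    · rcases tour_total h hac with h3 | h3
      · rw [p1]; exact pattern_of_path h ha hc hb h3 h2 hab
      · rw [p4]; exact pattern_of_path h hc ha hb h3 h1 hbc.symm
  · rcases tour_total h hac with h2 | h2
    · rw [p2]; exact pattern_of_path h hb ha hc h1 h2 hbc
    · rcases tour_total h hbc with h3 | h3
      · rw [p3]; exact pattern_of_path h hb hc ha h3 h2 hab.symm
      · rw [p5]; exact pattern_of_path h hc hb ha h3 h1 hac.symm

open Classical in
lemma sum_choose_le {V : Type} [Fintype V] {r : V → V → Prop} (h : IsTournament r) :
    ∑ v : V, ((univ.filter (fun w => r v w)).card).choose 3 ≤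
      patternCount r T4rel + patternCount r L4rel := by
  unfold patternCount
  refine le_trans ?_ (Finset.card_union_le _ _)
  have e : ∑ v : V, ((univ.filter (fun w => r v w)).card).choose 3 =
      ((univ : Finset V).sigma
        (fun v => (univ.filter (fun w => r v w)).powersetCard 3)).card := by
    rw [Finset.card_sigma]
    simp [Finset.card_powersetCard]
  rw [e]
  have key : ∀ p : (_ : V) × Finset V, p ∈ ((univ : Finset V).sigma
      (fun v => (univ.filter (fun w => r v w)).powersetCard 3)) →
      p.2.card = 3 ∧ ∀ w ∈ p.2, r p.1 w := by
    rintro ⟨v, s⟩ hp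
    simp only [Finset.mem_sigma, Finset.mem_powersetCard, Finset.mem_univ, true_and] at hp
    exact ⟨hp.2, fun w hw => (Finset.mem_filter.1 (hp.1 hw)).2⟩
  refine Finset.card_le_card_of_injOn (fun p => insert p.1 p.2) ?_ ?_
  · intro p hp
    obtain ⟨hc, hv⟩ := key p hp
    have hn : p.1 ∉ p.2 := fun hm => h.1 _ (hv _ hm)
    have hcard : (insert p.1 p.2).card = 4 := by
      rw [Finset.card_insert_of_notMem hn, hc]
    have := pattern_of_source h hc hv
    simp only [Finset.coe_union, Set.mem_union, Finset.mem_coe, Finset.mem_filter,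
      Finset.mem_powersetCard]
    rcases this with h1 | h1
    · exact Or.inl ⟨⟨Finset.subset_univ _, hcard⟩, h1⟩
    · exact Or.inr ⟨⟨Finset.subset_univ _, hcard⟩, h1⟩
  · rintro ⟨v, s⟩ hp ⟨v', s'⟩ hq heq
    obtain ⟨-, hv⟩ := key _ hp
    obtain ⟨-, hv'⟩ := key _ hq
    simp only at hv hv' heq
    have hvv : v = v' := by
      by_contra hne
      have m1 : v ∈ insert v' s' := heq ▸ Finset.mem_insert_self v s
      have m2 : v' ∈ insert v s := heq ▸ Finset.mem_insert_self v' s'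
      have m1' := (Finset.mem_insert.1 m1).resolve_left hne
      have m2' := (Finset.mem_insert.1 m2).resolve_left (Ne.symm hne)
      exact tour_asymm h (hv _ m2') (hv' _ m1')
    subst hvv
    have hn : v ∉ s := fun hm => h.1 _ (hv _ hm)
    have hn' : v ∉ s' := fun hm => h.1 _ (hv' _ hm)
    have : s = s' := by
      rw [← Finset.erase_insert hn, heq, Finset.erase_insert hn']
    rw [this]

open Classical in
lemma sum_deg {V : Type} [Fintype V] {r : V → V → Prop} (h : IsTournament r) :
    2 * ∑ v : V, ((univ.filter (fun w => r v w)).card : ℝ) =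
      (Fintype.card V : ℝ) * (Fintype.card V - 1) := by
  have e : ∀ v : V, ((univ.filter (fun w => r v w)).card : ℝ) =
      ∑ w : V, if r v w then (1 : ℝ) else 0 := by
    intro v
    simp
  simp_rw [e]
  rw [two_mul]
  nth_rewrite 2 [Finset.sum_comm]
  rw [← Finset.sum_add_distrib]
  have e2 : ∀ v : V, (∑ w : V, (if r v w then (1 : ℝ) else 0)) +
      ∑ w : V, (if r w v then (1 : ℝ) else 0) = (Fintype.card V : ℝ) - 1 := by
    intro v
    rw [← Finset.sum_add_distrib]
    have e3 : ∀ w : V, ((if r v w then (1 : ℝ) else 0) + if r w v then (1 : ℝ) else 0) =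
        1 - if v = w then (1 : ℝ) else 0 := by
      intro w
      by_cases hvw : v = w
      · subst hvw
        simp [h.1 v]
      · rcases tour_total h hvw with h1 | h1
        · simp [h1, tour_asymm h h1, hvw]
        · simp [h1, tour_asymm h h1, hvw]
    simp_rw [e3]
    rw [Finset.sum_sub_distrib]
    simp
  rw [Finset.sum_congr rfl (fun v _ => e2 v)]
  rw [Finset.sum_const, Finset.card_univ, nsmul_eq_mul]

lemma choose_three (d : ℕ) : ((d.choose 3 : ℕ) : ℝ) = (d : ℝ) * (d - 1) * (d - 2) / 6 := by
  induction d with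
  | zero => simp
  | succ k ih =>
    rw [Nat.choose_succ_succ' k 2]
    push_cast
    rw [ih, Nat.cast_choose_two]
    ring

lemma choose_four (d : ℕ) :
    ((d.choose 4 : ℕ) : ℝ) = (d : ℝ) * (d - 1) * (d - 2) * (d - 3) / 24 := by
  induction d with
  | zero => simp
  | succ k ih =>
    rw [Nat.choose_succ_succ' k 3]
    push_cast
    rw [ih, choose_three]
    ring

lemma count_bound_L {V : Type} [Fintype V] {r : V → V → Prop} (h : IsTournament r)
    (hn : 5 ≤ Fintype.card V) :
    ((Fintype.card V : ℝ) * (Fintype.card V - 1) * (Fintype.card V - 3) *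
          (Fintype.card V - 5)) / 48 ≤
        (patternCount r T4rel : ℝ) + (patternCount r L4rel : ℝ) := by
  classical
  have h1 := sum_choose_le h
  have h2 := sum_deg h
  have h1' : (∑ v : V, (((univ.filter (fun w => r v w)).card).choose 3 : ℝ)) ≤
      (patternCount r T4rel : ℝ) + (patternCount r L4rel : ℝ) := by
    exact_mod_cast h1
  refine le_trans ?_ h1'
  have hn' : (5 : ℝ) ≤ (Fintype.card V : ℝ) := by exact_mod_cast hn
  set n : ℝ := (Fintype.card V : ℝ) with hndef
  obtain ⟨m, hm⟩ : ∃ m : ℝ, m = (n - 1) / 2 := ⟨_, rfl⟩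
  have tangent : ∀ v : V, m * (m - 1) * (m - 2) / 6 +
      (3 * m ^ 2 - 6 * m + 2) / 6 * (((univ.filter (fun w => r v w)).card : ℝ) - m) ≤
      (((univ.filter (fun w => r v w)).card).choose 3 : ℝ) := by
    intro v
    rw [choose_three]
    have hd : (0 : ℝ) ≤ ((univ.filter (fun w => r v w)).card : ℝ) := Nat.cast_nonneg _
    generalize ((univ.filter (fun w => r v w)).card : ℝ) = d at hd
    have hpos : 0 ≤ (d - m) ^ 2 * (d + 2 * m - 3) :=
      mul_nonneg (sq_nonneg _) (by linarith)
    nlinarith [hpos]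
  have hsum := Finset.sum_le_sum (fun v (_ : v ∈ (univ : Finset V)) => tangent v)
  rw [Finset.sum_add_distrib, ← Finset.mul_sum, Finset.sum_sub_distrib] at hsum
  simp only [Finset.sum_const, Finset.card_univ, nsmul_eq_mul, ← hndef] at hsum
  refine le_trans (le_of_eq ?_) hsum
  have hs : ∑ v : V, ((univ.filter (fun w => r v w)).card : ℝ) = n * m := by
    rw [hm]; linarith
  rw [hs, hm]
  ring

lemma patternCount_mono {V : Type} [Fintype V] {k : ℕ} {r r' : V → V → Prop}
    {m m' : Fin k → Fin k → Prop}
    (h : ∀ s, InducesPattern r m s → InducesPattern r' m' s) :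
    patternCount r m ≤ patternCount r' m' := by
  classical
  unfold patternCount
  refine Finset.card_le_card ?_
  intro s hs
  rw [Finset.mem_filter] at hs ⊢
  exact ⟨hs.1, h s hs.2⟩

lemma induces_perm {V : Type} {k : ℕ} {r : V → V → Prop}
    {m m' : Fin k → Fin k → Prop} (e : Equiv.Perm (Fin k))
    (he : ∀ i j, m' i j ↔ m (e j) (e i)) (s : Finset V)
    (h : InducesPattern (fun x y => r y x) m s) : InducesPattern r m' s := by
  obtain ⟨f, hf, hr, hm⟩ := h
  refine ⟨f ∘ e, hf.comp e.injective, ?_, ?_⟩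
  · rw [e.surjective.range_comp, hr]
  · intro i j
    rw [he, hm]
    rfl

lemma count_bound_W {V : Type} [Fintype V] {r : V → V → Prop} (h : IsTournament r)
    (hn : 5 ≤ Fintype.card V) :
    ((Fintype.card V : ℝ) * (Fintype.card V - 1) * (Fintype.card V - 3) *
          (Fintype.card V - 5)) / 48 ≤
        (patternCount r T4rel : ℝ) + (patternCount r W4rel : ℝ) := by
  refine le_trans (count_bound_L (tour_flip h) hn) ?_
  have h1 : patternCount (fun x y => r y x) T4rel ≤ patternCount r T4rel :=
    patternCount_mono (induces_perm Fin.revPerm (by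
      intro i j
      simp [T4rel]))
  have h2 : patternCount (fun x y => r y x) L4rel ≤ patternCount r W4rel :=
    patternCount_mono (induces_perm (Equiv.swap 0 1) (by
      unfold W4rel L4rel
      decide))
  exact_mod_cast Nat.add_le_add h1 h2

lemma density_bound {n c d ε : ℝ} (hn : 5 ≤ n) (hε : 0 < ε) (hN : 3 / ε + 2 ≤ n)
    (h : n * (n - 1) * (n - 3) * (n - 5) / 48 ≤ c + d) :
    1 / 2 - ε ≤ c / (n * (n - 1) * (n - 2) * (n - 3) / 24) +
      d / (n * (n - 1) * (n - 2) * (n - 3) / 24) := by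
  have p : 0 < n * (n - 1) * (n - 3) :=
    mul_pos (mul_pos (by linarith) (by linarith)) (by linarith)
  have p2 : 0 < n - 2 := by linarith
  have hpos : 0 < n * (n - 1) * (n - 2) * (n - 3) / 24 := by
    have := mul_pos p p2
    nlinarith [this]
  rw [← add_div, le_div_iff₀ hpos]
  refine le_trans ?_ h
  have h3 : 3 ≤ (n - 2) * ε := by
    rw [← div_le_iff₀ hε]
    linarith
  have := mul_nonneg p.le (show 0 ≤ 2 * ((n - 2) * ε) - 3 by linarith)
  nlinarith [this]

/-- For every tournament on `n ≥ 5` vertices, the number of 4-subsets inducing `T₄` plus the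
number inducing `L₄` is at least `n(n-1)(n-3)(n-5)/48`, and likewise for `T₄` and `W₄`;
consequently `t₄ + l₄ ≥ 1/2 - ε` and `t₄ + w₄ ≥ 1/2 - ε` for all large tournaments. -/
theorem t4_plus_l4_and_t4_plus_w4_lower_bounds :
    (∀ (V : Type) [Fintype V] (r : V → V → Prop), IsTournament r →
      5 ≤ Fintype.card V →
      ((Fintype.card V : ℝ) * (Fintype.card V - 1) * (Fintype.card V - 3) *
          (Fintype.card V - 5)) / 48 ≤
        (patternCount r T4rel : ℝ) + (patternCount r L4rel : ℝ) ∧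
      ((Fintype.card V : ℝ) * (Fintype.card V - 1) * (Fintype.card V - 3) *
          (Fintype.card V - 5)) / 48 ≤
        (patternCount r T4rel : ℝ) + (patternCount r W4rel : ℝ)) ∧
    ∀ ε : ℝ, 0 < ε → ∃ N : ℕ, ∀ (V : Type) [Fintype V] (r : V → V → Prop),
      IsTournament r → N ≤ Fintype.card V →
      1 / 2 - ε ≤ patternDensity r T4rel + patternDensity r L4rel ∧
      1 / 2 - ε ≤ patternDensity r T4rel + patternDensity r W4rel := by
  refine ⟨fun V _ r h hn => ⟨count_bound_L h hn, count_bound_W h hn⟩, ?_⟩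
  intro ε hε
  obtain ⟨N, hN⟩ := exists_nat_ge (3 / ε + 2)
  refine ⟨max 5 N, ?_⟩
  intro V _ r h hn
  have h5 : 5 ≤ Fintype.card V := le_trans (le_max_left _ _) hn
  have hNn : N ≤ Fintype.card V := le_trans (le_max_right _ _) hn
  have h5' : (5 : ℝ) ≤ (Fintype.card V : ℝ) := by exact_mod_cast h5
  have hN' : 3 / ε + 2 ≤ (Fintype.card V : ℝ) := hN.trans (by exact_mod_cast hNn)
  unfold patternDensity
  rw [choose_four]
  exact ⟨density_bound h5' hε hN' (count_bound_L h h5),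
    density_bound h5' hε hN' (count_bound_W h h5)⟩
end
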